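/- arXiv:2107.09721 — 5 statements merged into one kernel-verified Lean document; each statement's English description precedes it below -/
import Mathlib

section
/- Let z and y be real-valued random variables on a common probability space (possibly dependent) with z ∼ subW(θ₁, ν₁) and y ∼ subW(θ₂, ν₂). Then the product z·y ∼ subW(θ₁ + θ₂, ψ(θ₁, θ₂) ν₁ ν₂), where ψ(θ₁, θ₂) = (θ₁ + θ₂)^{θ₁ + θ₂} / (θ₁^{θ₁} θ₂^{θ₂}). -/
open MeasureTheory

/-- A real-valued random variable `z` is sub-Weibull with tail parameter `θ > 0` and
scale `ν > 0` if its `k`-th moment norm `(E[|z|^k])^{1/k}` is at most `ν k^θ`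
for every real `k ≥ 1`. -/
def IsSubWeibull {Ω : Type*} [MeasurableSpace Ω] (P : Measure Ω) (θ ν : ℝ)
    (z : Ω → ℝ) : Prop :=
  ∀ k : ℝ, 1 ≤ k → eLpNorm z (ENNReal.ofReal k) P ≤ ENNReal.ofReal (ν * k ^ θ)

theorem ENNReal.holderTriple_ofReal {p q r : ℝ} (hp : 0 < p) (hq : 0 < q) (hr : 0 < r)
    (h : p⁻¹ + q⁻¹ = r⁻¹) :
    ENNReal.HolderTriple (ENNReal.ofReal p) (ENNReal.ofReal q) (ENNReal.ofReal r) where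
  inv_add_inv_eq_inv := by
    rw [← ENNReal.ofReal_inv_of_pos hp, ← ENNReal.ofReal_inv_of_pos hq,
      ← ENNReal.ofReal_inv_of_pos hr, ← ENNReal.ofReal_add (by positivity) (by positivity), h]

/-- Closure of sub-Weibull random variables under multiplication:
`z·y ∼ subW(θ₁ + θ₂, ψ(θ₁, θ₂) ν₁ ν₂)` with
`ψ(θ₁, θ₂) = (θ₁ + θ₂)^(θ₁+θ₂) / (θ₁^θ₁ θ₂^θ₂)`. -/
theorem subWeibull_mul {Ω : Type*} [MeasurableSpace Ω] (P : Measure Ω)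
    [IsProbabilityMeasure P] (θ₁ θ₂ ν₁ ν₂ : ℝ)
    (hθ₁ : 0 < θ₁) (hθ₂ : 0 < θ₂) (hν₁ : 0 < ν₁) (hν₂ : 0 < ν₂)
    (z y : Ω → ℝ) (hz : Measurable z) (hy : Measurable y)
    (hzsw : IsSubWeibull P θ₁ ν₁ z) (hysw : IsSubWeibull P θ₂ ν₂ y) :
    IsSubWeibull P (θ₁ + θ₂)
      ((θ₁ + θ₂) ^ (θ₁ + θ₂) / (θ₁ ^ θ₁ * θ₂ ^ θ₂) * ν₁ * ν₂)
      (fun ω => z ω * y ω) := by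
  intro k hk
  have hk0 : 0 < k := by linarith
  set s := θ₁ + θ₂ with hs
  have hs0 : 0 < s := by positivity
  have hp : 1 ≤ k * (s / θ₁) :=
    one_le_mul_of_one_le_of_one_le hk ((one_le_div hθ₁).2 (by linarith))
  have hq : 1 ≤ k * (s / θ₂) :=
    one_le_mul_of_one_le_of_one_le hk ((one_le_div hθ₂).2 (by linarith))
  have := ENNReal.holderTriple_ofReal (p := k * (s / θ₁)) (q := k * (s / θ₂)) (r := k)
    (by positivity) (by positivity) hk0 (by field_simp; exact hs.symm)
  calc eLpNorm (z • y) (ENNReal.ofReal k) P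
      ≤ eLpNorm z (ENNReal.ofReal (k * (s / θ₁))) P
          * eLpNorm y (ENNReal.ofReal (k * (s / θ₂))) P :=
        eLpNorm_smul_le_mul_eLpNorm hy.aestronglyMeasurable hz.aestronglyMeasurable
    _ ≤ ENNReal.ofReal (ν₁ * (k * (s / θ₁)) ^ θ₁) * ENNReal.ofReal (ν₂ * (k * (s / θ₂)) ^ θ₂) :=
        mul_le_mul' (hzsw _ hp) (hysw _ hq)
    _ = ENNReal.ofReal (s ^ s / (θ₁ ^ θ₁ * θ₂ ^ θ₂) * ν₁ * ν₂ * k ^ s) := by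
        have hpow {x : ℝ} (hx : 0 < x) : x ^ s = x ^ θ₁ * x ^ θ₂ := Real.rpow_add hx θ₁ θ₂
        rw [← ENNReal.ofReal_mul (by positivity), hpow hs0, hpow hk0,
          Real.mul_rpow hk0.le (by positivity), Real.mul_rpow hk0.le (by positivity),
          Real.div_rpow hs0.le hθ₁.le, Real.div_rpow hs0.le hθ₂.le]
        congr 1
        ring
end

section
/- Let E be a finite-dimensional real inner product space, let f : E → ℝ be differentiable with gradient map g : E → E (i.e., g(x) is the gradient of f at every x), suppose f is α-strongly convex with α > 0, suppose g is β-Lipschitz with 0 < α ≤ β, and let η > 0. Then for all x, y ∈ E: ‖(x − η g(x)) − (y − η g(y))‖ ≤ ρ ‖x − y‖, where ρ = max{|1 − η α|, |1 − η β|}. -/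
open scoped RealInnerProductSpace

section GradientInequalities

variable {E : Type*} [NormedAddCommGroup E] [InnerProductSpace ℝ E] [CompleteSpace E]

theorem HasGradientAt.hasDerivAt_comp_line {h : E → ℝ} {h' x v : E} {t : ℝ}
    (hh : HasGradientAt h h' (x + t • v)) :
    HasDerivAt (fun s : ℝ => h (x + s • v)) ⟪h', v⟫ t := by
  have hline : HasDerivAt (fun s : ℝ => x + s • v) v t := by
    simpa using ((hasDerivAt_id t).smul_const v).const_add x
  simpa [Function.comp_def] using hh.hasFDerivAt.comp_hasDerivAt t hline

theorem ConvexOn.add_inner_le_of_hasGradientAt {h : E → ℝ} {h' x : E}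
    (hc : ConvexOn ℝ Set.univ h) (hh : HasGradientAt h h' x) (y : E) :
    h x + ⟪h', y - x⟫ ≤ h y := by
  have hconv : ConvexOn ℝ Set.univ (fun s : ℝ => h (x + s • (y - x))) := by
    simpa [Function.comp_def, AffineMap.lineMap_apply, add_comm] using
      hc.comp_affineMap (AffineMap.lineMap x y : ℝ →ᵃ[ℝ] E)
  have hderiv : HasDerivAt (fun s : ℝ => h (x + s • (y - x))) ⟪h', y - x⟫ 0 :=
    HasGradientAt.hasDerivAt_comp_line (by simpa using hh)
  have hslope := hconv.le_slope_of_hasDerivAt (Set.mem_univ 0) (Set.mem_univ 1) one_pos hderiv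
  simp only [slope_def_field, one_smul, zero_smul, add_zero, sub_zero, div_one,
    add_sub_cancel] at hslope
  linarith

/-- The descent lemma, under a one-sided Lipschitz condition on the gradient. -/
theorem le_add_inner_add_of_inner_gradient_sub_le {h : E → ℝ} {H : E → E} {L : ℝ}
    (hh : ∀ x, HasGradientAt h (H x) x)
    (hL : ∀ x y, ⟪H x - H y, x - y⟫ ≤ L * ‖x - y‖ ^ 2) (x y : E) :
    h y ≤ h x + ⟪H x, y - x⟫ + L / 2 * ‖y - x‖ ^ 2 := by
  set v := y - x with hv
  have hderiv (t : ℝ) : HasDerivAt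
      (fun s : ℝ => h (x + s • v) - s * ⟪H x, v⟫ - s ^ 2 * (L / 2 * ‖v‖ ^ 2))
      (⟪H (x + t • v), v⟫ - ⟪H x, v⟫ - 2 * t * (L / 2 * ‖v‖ ^ 2)) t := by
    simpa using (((hh (x + t • v)).hasDerivAt_comp_line).fun_sub
      ((hasDerivAt_id t).mul_const ⟪H x, v⟫)).fun_sub
        ((hasDerivAt_pow 2 t).mul_const (L / 2 * ‖v‖ ^ 2))
  have hanti := antitoneOn_of_deriv_nonpos (convex_Icc (0 : ℝ) 1)
    (fun t _ => (hderiv t).continuousAt.continuousWithinAt)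
    (fun t _ => (hderiv t).differentiableAt.differentiableWithinAt) (by
      intro t ht
      rw [interior_Icc] at ht
      rw [(hderiv t).deriv]
      have hbound := hL (x + t • v) x
      rw [add_sub_cancel_left, inner_smul_right, norm_smul, Real.norm_of_nonneg ht.1.le,
        inner_sub_left] at hbound
      refine nonpos_of_mul_nonpos_right ?_ ht.1
      linarith)
  have hle := hanti (Set.left_mem_Icc.2 zero_le_one) (Set.right_mem_Icc.2 zero_le_one) zero_le_one
  simp only [one_smul, zero_smul, add_zero] at hle
  rw [show x + v = y by simp [hv]] at hle
  linarith

/-- The Baillon–Haddad inequality (cocoercivity of the gradient of a convex function). -/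
theorem ConvexOn.norm_gradient_sub_sq_le {h : E → ℝ} {H : E → E} {L : ℝ}
    (hc : ConvexOn ℝ Set.univ h) (hh : ∀ x, HasGradientAt h (H x) x) (hL0 : 0 ≤ L)
    (hL : ∀ x y, ⟪H x - H y, x - y⟫ ≤ L * ‖x - y‖ ^ 2) (x y : E) :
    ‖H x - H y‖ ^ 2 ≤ L * ⟪H x - H y, x - y⟫ := by
  have gap (t : ℝ) (a b : E) :
      (t - L / 2 * t ^ 2) * ‖H a - H b‖ ^ 2 ≤ h a - h b - ⟪H b, a - b⟫ := by
    have hlow := hc.add_inner_le_of_hasGradientAt (hh b) (a - t • (H a - H b))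
    have hupp := le_add_inner_add_of_inner_gradient_sub_le hh hL a (a - t • (H a - H b))
    rw [sub_sub_cancel_left, inner_neg_right, norm_neg, norm_smul, mul_pow, Real.norm_eq_abs,
      sq_abs, inner_smul_right] at hupp
    rw [sub_right_comm, inner_sub_right, inner_smul_right] at hlow
    have hnorm : ‖H a - H b‖ ^ 2 = ⟪H a, H a - H b⟫ - ⟪H b, H a - H b⟫ := by
      rw [← inner_sub_left, real_inner_self_eq_norm_sq]
    linear_combination hlow + hupp + t * hnorm
  have key (t : ℝ) : (2 * t - L * t ^ 2) * ‖H x - H y‖ ^ 2 ≤ ⟪H x - H y, x - y⟫ := by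
    have hxy := gap t x y
    have hyx := gap t y x
    rw [norm_sub_rev, ← neg_sub x y, inner_neg_right] at hyx
    rw [inner_sub_left]
    linarith
  rcases hL0.eq_or_lt with rfl | hpos
  · have hone := key 1
    have hzero := hL x y
    linarith
  · have hinv := key L⁻¹
    rw [show 2 * L⁻¹ - L * L⁻¹ ^ 2 = L⁻¹ by field_simp; ring] at hinv
    exact (inv_mul_le_iff₀ hpos).1 hinv

end GradientInequalities

/-- The gradient-step map of an `α`-strongly convex function with `β`-Lipschitz
gradient is Lipschitz with constant `ρ = max{|1 − ηα|, |1 − ηβ|}`. -/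
theorem gradient_step_contraction
    {E : Type*} [NormedAddCommGroup E] [InnerProductSpace ℝ E]
    [FiniteDimensional ℝ E]
    (f : E → ℝ) (g : E → E) (α β η : ℝ)
    (hα : 0 < α) (hαβ : α ≤ β) (hη : 0 < η)
    (hgrad : ∀ x, HasGradientAt f (g x) x)
    (hsc : ConvexOn ℝ Set.univ (fun x => f x - α / 2 * ‖x‖ ^ 2))
    (hglip : ∀ x y, ‖g x - g y‖ ≤ β * ‖x - y‖) :
    ∀ x y : E, ‖(x - η • g x) - (y - η • g y)‖ ≤
      max |1 - η * α| |1 - η * β| * ‖x - y‖ := by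
  have : CompleteSpace E := FiniteDimensional.complete ℝ E
  intro x y
  have hgradH (z : E) :
      HasGradientAt (fun x => f x - α / 2 * ‖x‖ ^ 2) (g z - α • z) z := by
    rw [hasGradientAt_iff_hasFDerivAt]
    refine ((hgrad z).hasFDerivAt.fun_sub
      ((hasStrictFDerivAt_norm_sq z).hasFDerivAt.const_mul (α / 2))).congr_fderiv ?_
    ext v
    simp
    ring
  have hsub (a b : E) : (g a - α • a) - (g b - α • b) = (g a - g b) - α • (a - b) := by
    module
  have hL (a b : E) : ⟪(g a - α • a) - (g b - α • b), a - b⟫ ≤ (β - α) * ‖a - b‖ ^ 2 := by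
    rw [hsub, inner_sub_left, real_inner_smul_left, real_inner_self_eq_norm_sq]
    have hcs := real_inner_le_norm (g a - g b) (a - b)
    have hmul := mul_le_mul_of_nonneg_right (hglip a b) (norm_nonneg (a - b))
    linarith
  have hcoco := hsc.norm_gradient_sub_sq_le hgradH (sub_nonneg.2 hαβ) hL x y
  have hupp := hL x y
  have hmono : 0 ≤ ⟪(g x - α • x) - (g y - α • y), x - y⟫ := by
    have hxy := hsc.add_inner_le_of_hasGradientAt (hgradH x) y
    have hyx := hsc.add_inner_le_of_hasGradientAt (hgradH y) x
    rw [← neg_sub x y, inner_neg_right] at hxy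
    rw [inner_sub_left]
    linarith
  have hstep : (x - η • g x) - (y - η • g y) =
      (1 - η * α) • (x - y) - η • ((g x - α • x) - (g y - α • y)) := by
    module
  rw [hstep]
  generalize (g x - α • x) - (g y - α • y) = d at *
  generalize x - y = e at *
  set ρ := max |1 - η * α| |1 - η * β|
  have hρα : (1 - η * α) ^ 2 ≤ ρ ^ 2 := by
    rw [← sq_abs (1 - η * α)]
    exact pow_le_pow_left₀ (abs_nonneg _) (le_max_left _ _) 2
  have hρβ : (1 - η * β) ^ 2 ≤ ρ ^ 2 := by
    rw [← sq_abs (1 - η * β)]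
    exact pow_le_pow_left₀ (abs_nonneg _) (le_max_right _ _) 2
  have hρ : 0 ≤ ρ := (abs_nonneg _).trans (le_max_left _ _)
  refine (sq_le_sq₀ (norm_nonneg _) (by positivity)).1 ?_
  have hexpand : ‖(1 - η * α) • e - η • d‖ ^ 2 =
      (1 - η * α) ^ 2 * ‖e‖ ^ 2 - 2 * η * (1 - η * α) * ⟪d, e⟫ + η ^ 2 * ‖d‖ ^ 2 := by
    rw [norm_sub_sq_real, norm_smul, norm_smul, real_inner_smul_left, real_inner_smul_right,
      real_inner_comm, mul_pow, mul_pow, Real.norm_eq_abs, Real.norm_eq_abs, sq_abs, sq_abs]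
    ring
  rw [hexpand, mul_pow]
  have hη2 := mul_le_mul_of_nonneg_left hcoco (sq_nonneg η)
  have hρα' := mul_le_mul_of_nonneg_right hρα (sq_nonneg ‖e‖)
  have hρβ' := mul_le_mul_of_nonneg_right hρβ (sq_nonneg ‖e‖)
  -- The remaining bound is affine in `⟪d, e⟫`, which ranges over `[0, (β - α) * ‖e‖ ^ 2]`.
  rcases le_total (η * (β - α) - 2 * (1 - η * α)) 0 with hneg | hpos
  · have := mul_nonneg (mul_nonneg hη.le (neg_nonneg.2 hneg)) hmono
    linarith
  · have := mul_le_mul_of_nonneg_left hupp (mul_nonneg hη.le hpos)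
    linarith
end

section
/- Let E be a finite-dimensional real inner product space, let C ⊆ E be nonempty, closed and convex, and let f : E × E → ℝ and g : E × E → E be such that for every fixed y ∈ E: (i) x ↦ f(x, y) is differentiable with gradient g(·, y) and is α-strongly convex (α > 0); and (ii) for every fixed x ∈ E, the map y ↦ g(x, y) is L-Lipschitz (L ≥ 0). Let S : E → E assign to each y a minimizer of x ↦ f(x, y) over C, i.e., S(y) ∈ C and f(S(y), y) ≤ f(x, y) for all x ∈ C. Then S is (L/α)-Lipschitz: ‖S(y) − S(y')‖ ≤ (L/α)‖y − y'‖ for all y, y' ∈ E. Moreover, if L/α < 1, then there exists a unique point x̄ ∈ C with x̄ = S(x̄), i.e., a unique performatively stable point exists. -/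
open InnerProductSpace in
/-- A convex function lies above its tangent hyperplane at a point of differentiability. -/
theorem ConvexOn.add_inner_gradient_le {E : Type*} [NormedAddCommGroup E] [InnerProductSpace ℝ E]
    [CompleteSpace E] {h : E → ℝ} {p x : E} (hconv : ConvexOn ℝ Set.univ h)
    (hp : HasGradientAt h p x) (z : E) : h x + inner ℝ p (z - x) ≤ h z := by
  have hline : ConvexOn ℝ Set.univ (h ∘ AffineMap.lineMap (k := ℝ) x z) := by
    simpa using hconv.comp_affineMap (AffineMap.lineMap (k := ℝ) x z)
  have hderiv : HasDerivAt (h ∘ AffineMap.lineMap (k := ℝ) x z) (inner ℝ p (z - x)) 0 := by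
    have hf : HasFDerivAt h (toDual ℝ E p) (AffineMap.lineMap x z (0 : ℝ)) := by
      simpa using hp.hasFDerivAt
    simpa using hf.comp_hasDerivAt (0 : ℝ) (AffineMap.hasDerivAt_lineMap (a := x) (b := z))
  have := hline.le_slope_of_hasDerivAt (Set.mem_univ 0) (Set.mem_univ 1) one_pos hderiv
  simp only [slope_def_field, Function.comp_apply, AffineMap.lineMap_apply_zero,
    AffineMap.lineMap_apply_one, sub_zero, div_one] at this
  linarith

open InnerProductSpace in
/-- First-order strong convexity: the gradient of a strongly convex function is strongly
monotone. -/
theorem strongly_monotone_gradient {E : Type*} [NormedAddCommGroup E] [InnerProductSpace ℝ E]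
    [CompleteSpace E] {h : E → ℝ} {α : ℝ} {p q x z : E}
    (hconv : ConvexOn ℝ Set.univ (fun w => h w - α / 2 * ‖w‖ ^ 2))
    (hp : HasGradientAt h p x) (hq : HasGradientAt h q z) :
    α * ‖x - z‖ ^ 2 ≤ inner ℝ (p - q) (x - z) := by
  have hgrad {r w : E} (hr : HasGradientAt h r w) :
      HasGradientAt (fun w => h w - α / 2 * ‖w‖ ^ 2) (r - α • w) w := by
    rw [hasGradientAt_iff_hasFDerivAt] at hr ⊢
    refine (hr.sub ((hasStrictFDerivAt_norm_sq w).hasFDerivAt.const_mul (α / 2))).congr_fderiv ?_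
    ext v
    simp only [map_sub, map_smul, sub_apply, smul_apply,
      toDual_apply_apply, innerSL_apply_apply, smul_eq_mul, nsmul_eq_mul]
    push_cast
    ring
  have hx := hconv.add_inner_gradient_le (hgrad hp) z
  have hz := hconv.add_inner_gradient_le (hgrad hq) x
  have hsum : 0 ≤ inner ℝ (p - α • x - (q - α • z)) (x - z) := by
    rw [← neg_sub x z, inner_neg_right] at hx
    rw [inner_sub_left]
    linarith
  have heq : p - α • x - (q - α • z) = (p - q) - α • (x - z) := by module
  rw [heq, inner_sub_left, real_inner_smul_left, real_inner_self_eq_norm_sq] at hsum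
  linarith

/-- First-order optimality condition (variational inequality) on a convex set. -/
theorem IsMinOn.inner_gradient_nonneg {E : Type*} [NormedAddCommGroup E] [InnerProductSpace ℝ E]
    [CompleteSpace E] {C : Set E} {h : E → ℝ} {p x z : E} (hmin : IsMinOn h C x)
    (hC : Convex ℝ C) (hx : x ∈ C) (hz : z ∈ C) (hp : HasGradientAt h p x) :
    0 ≤ inner ℝ p (z - x) := by
  simpa using hmin.localize.hasFDerivWithinAt_nonneg hp.hasFDerivAt.hasFDerivWithinAt
    (sub_mem_posTangentConeAt_of_segment_subset (hC.segment_subset hx hz))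

/-- Existence of performatively stable points: the solution map
`S(y) ∈ argmin_{x ∈ C} f(x, y)` of an `α`-strongly convex objective whose gradient is
`L`-Lipschitz in `y` is `(L/α)`-Lipschitz; if moreover `L/α < 1`, a unique
performatively stable point `x̄ ∈ C` with `x̄ = S(x̄)` exists. -/
theorem performatively_stable_exists
    {E : Type*} [NormedAddCommGroup E] [InnerProductSpace ℝ E]
    [FiniteDimensional ℝ E]
    (C : Set E) (hCne : C.Nonempty) (hCclosed : IsClosed C) (hCconv : Convex ℝ C)
    (f : E → E → ℝ) (g : E → E → E) (α L : ℝ) (hα : 0 < α) (hL : 0 ≤ L)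
    (hgrad : ∀ y x, HasGradientAt (fun x' => f x' y) (g x y) x)
    (hsc : ∀ y, ConvexOn ℝ Set.univ (fun x => f x y - α / 2 * ‖x‖ ^ 2))
    (hglip : ∀ x y y', ‖g x y - g x y'‖ ≤ L * ‖y - y'‖)
    (S : E → E)
    (hS : ∀ y, S y ∈ C ∧ ∀ x ∈ C, f (S y) y ≤ f x y) :
    (∀ y y' : E, ‖S y - S y'‖ ≤ L / α * ‖y - y'‖) ∧
      (L / α < 1 → ∃! xb : E, xb ∈ C ∧ S xb = xb) := by
  have hlip : ∀ y y' : E, ‖S y - S y'‖ ≤ L / α * ‖y - y'‖ := by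
    intro y y'
    have hmono := strongly_monotone_gradient (hsc y) (hgrad y (S y)) (hgrad y (S y'))
    have hopt (u v : E) : 0 ≤ inner ℝ (g (S u) u) (S v - S u) :=
      IsMinOn.inner_gradient_nonneg (h := fun x => f x u) (hS u).2 hCconv (hS u).1 (hS v).1
        (hgrad u (S u))
    have hy := hopt y y'
    have hy' := hopt y' y
    have hcs : inner ℝ (g (S y') y' - g (S y') y) (S y - S y')
        ≤ L * ‖y - y'‖ * ‖S y - S y'‖ := by
      refine (real_inner_le_norm _ _).trans ?_
      gcongr
      rw [norm_sub_rev y y']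
      exact hglip _ _ _
    rw [← neg_sub (S y), inner_neg_right] at hy
    rw [inner_sub_left] at hmono hcs
    rw [div_mul_eq_mul_div, le_div_iff₀ hα]
    rcases (norm_nonneg (S y - S y')).eq_or_lt with h0 | hpos
    · rw [← h0]
      simpa using mul_nonneg hL (norm_nonneg (y - y'))
    · refine le_of_mul_le_mul_right ?_ hpos
      linarith
  refine ⟨hlip, fun hlt => ?_⟩
  have hK : 0 ≤ L / α := div_nonneg hL hα.le
  have hcontr : ContractingWith (L / α).toNNReal S := by
    refine ⟨by simpa using hlt, LipschitzWith.of_dist_le_mul fun y y' => ?_⟩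
    simpa [dist_eq_norm, Real.coe_toNNReal _ hK] using hlip y y'
  have hfix : S (hcontr.fixedPoint S) = hcontr.fixedPoint S := hcontr.fixedPoint_isFixedPt
  exact ⟨hcontr.fixedPoint S, ⟨hfix ▸ (hS _).1, hfix⟩,
    fun y hy => hcontr.fixedPoint_unique hy.2⟩
end

section
/- Let E be a finite-dimensional real inner product space, let C ⊆ E be nonempty, closed and convex, and let f : E × E → ℝ satisfy: (i) for every fixed y ∈ E, the map x ↦ f(x, y) is α-strongly convex (α > 0); and (ii) for every fixed x ∈ E, the map y ↦ f(x, y) is K-Lipschitz (K ≥ 0). Suppose x̄ ∈ C minimizes x ↦ f(x, x̄) over C (a performatively stable point) and x* ∈ C minimizes x ↦ f(x, x) over C (a performatively optimal point). Then ‖x̄ − x*‖ ≤ 2K/α. (In the paper K = ε γ, with γ the Lipschitz constant of the loss in z and ε the sensitivity of the distributional map, giving ‖x̄ − x*‖ ≤ 2 ε γ / α.) -/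
/-- Quadratic growth of a strongly convex function at a minimizer. -/
theorem StrongConvexOn.add_sq_le_of_isMinOn {E : Type*} [NormedAddCommGroup E] [NormedSpace ℝ E]
    {C : Set E} {h : E → ℝ} {α : ℝ} (hh : StrongConvexOn C α h) {a x : E}
    (hmin : IsMinOn h C a) (ha : a ∈ C) (hx : x ∈ C) :
    h a + α / 2 * ‖a - x‖ ^ 2 ≤ h x := by
  have key : ∀ t : ℝ, 0 < t → t < 1 → (1 - t) * (α / 2 * ‖a - x‖ ^ 2) ≤ h x - h a := by
    intro t ht ht1
    have h1 := hh.2 ha hx (sub_nonneg.2 ht1.le) ht.le (by ring)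
    have h2 := isMinOn_iff.1 hmin _ (hh.1 ha hx (sub_nonneg.2 ht1.le) ht.le (by ring))
    simp only [smul_eq_mul] at h1
    refine le_of_mul_le_mul_left ?_ ht
    linarith
  have hlim : Filter.Tendsto (fun t : ℝ => (1 - t) * (α / 2 * ‖a - x‖ ^ 2))
      (nhdsWithin 0 (Set.Ioi 0)) (nhds ((1 - 0) * (α / 2 * ‖a - x‖ ^ 2))) :=
    (Continuous.tendsto (by fun_prop) 0).mono_left nhdsWithin_le_nhds
  have hle := le_of_tendsto hlim (by
    filter_upwards [Ioo_mem_nhdsGT (zero_lt_one (α := ℝ))] with t ht using key t ht.1 ht.2)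
  linarith


/-- Error bound between performatively stable and performatively optimal points:
if `x ↦ f(x, y)` is `α`-strongly convex for each `y`, and `y ↦ f(x, y)` is
`K`-Lipschitz for each `x`, then any performatively stable point `x̄` and any
performatively optimal point `x*` satisfy `‖x̄ − x*‖ ≤ 2K/α`. -/
theorem performatively_stable_error_bound
    {E : Type*} [NormedAddCommGroup E] [InnerProductSpace ℝ E]
    [FiniteDimensional ℝ E]
    (C : Set E) (hCne : C.Nonempty) (hCclosed : IsClosed C) (hCconv : Convex ℝ C)
    (f : E → E → ℝ) (α K : ℝ) (hα : 0 < α) (hK : 0 ≤ K)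
    (hsc : ∀ y, ConvexOn ℝ Set.univ (fun x => f x y - α / 2 * ‖x‖ ^ 2))
    (hKlip : ∀ x y y', |f x y - f x y'| ≤ K * ‖y - y'‖)
    (xb : E) (hxbC : xb ∈ C) (hxb : ∀ x ∈ C, f xb xb ≤ f x xb)
    (xs : E) (hxsC : xs ∈ C) (hxs : ∀ x ∈ C, f xs xs ≤ f x x) :
    ‖xb - xs‖ ≤ 2 * K / α := by
  have hgrowth : f xb xb + α / 2 * ‖xb - xs‖ ^ 2 ≤ f xs xb :=
    StrongConvexOn.add_sq_le_of_isMinOn (h := fun x => f x xb)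
      (strongConvexOn_iff_convex.2 ((hsc xb).subset (Set.subset_univ C) hCconv))
      (isMinOn_iff.2 hxb) hxbC hxsC
  have hlip := (le_abs_self _).trans (hKlip xs xb xs)
  have hopt := hxs xb hxbC
  rw [le_div_iff₀ hα]
  rcases (norm_nonneg (xb - xs)).eq_or_lt with h0 | hpos
  · rw [← h0]
    linarith
  · refine le_of_mul_le_mul_right ?_ hpos
    linarith
end

section
/- Let E be a finite-dimensional real inner product space, let C ⊆ E be nonempty, closed and convex with Euclidean projection proj_C, and let f : E × E → ℝ and g : E × E → E satisfy, with constants 0 < α ≤ β and ε ≥ 0 such that β ε / α < 1: (i) for every y, x ↦ f(x, y) is differentiable with gradient g(·, y) and is α-strongly convex; (ii) g(·, y) is β-Lipschitz; (iii) for every x, y ↦ g(x, y) is (β ε)-Lipschitz. Suppose x̄ ∈ E satisfies x̄ = proj_C(x̄ − η g(x̄, x̄)), and let x_{t+1} = proj_C(x_t − η g(x_t, x_t)) with fixed step size η ∈ (0, 2/(β(1 + ε))). Then λ := max{|1 − η α|, |1 − η β|} + η β ε < 1 and ‖x_{t+1} − x̄‖ ≤ λ ‖x_t − x̄‖ for all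 t; in particular ‖x_t − x̄‖ ≤ λ^t ‖x_0 − x̄‖, so the iterates converge linearly to the performatively stable point. -/
open scoped InnerProductSpace

section Projection

variable {E : Type*} [NormedAddCommGroup E] [InnerProductSpace ℝ E] {C : Set E} {p q u v : E}

/-- Variational inequality for a nearest point of a convex set. -/
theorem Convex.inner_sub_nearest_le_zero (hC : Convex ℝ C) (hp : p ∈ C)
    (hmin : ∀ w ∈ C, ‖u - p‖ ≤ ‖u - w‖) {w : E} (hw : w ∈ C) : ⟪u - p, w - p⟫_ℝ ≤ 0 := by
  have : Nonempty C := ⟨⟨p, hp⟩⟩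
  refine (norm_eq_iInf_iff_real_inner_le_zero hC hp).1 (le_antisymm ?_ ?_) w hw
  · exact le_ciInf fun w => hmin w w.2
  · exact ciInf_le ⟨0, by rintro _ ⟨w, rfl⟩; exact norm_nonneg _⟩ (⟨p, hp⟩ : C)

/-- Taking nearest points of a convex set is nonexpansive. -/
theorem Convex.norm_nearest_sub_nearest_le (hC : Convex ℝ C)
    (hp : p ∈ C) (hpmin : ∀ w ∈ C, ‖u - p‖ ≤ ‖u - w‖)
    (hq : q ∈ C) (hqmin : ∀ w ∈ C, ‖v - q‖ ≤ ‖v - w‖) : ‖p - q‖ ≤ ‖u - v‖ := by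
  have h1 := hC.inner_sub_nearest_le_zero hp hpmin hq
  have h2 := hC.inner_sub_nearest_le_zero hq hqmin hp
  have h3 : ‖p - q‖ * ‖p - q‖ ≤ ⟪u - v, p - q⟫_ℝ := by
    rw [← real_inner_self_eq_norm_mul_norm]
    simp only [inner_sub_left, inner_sub_right] at *
    linarith
  have h4 := h3.trans (real_inner_le_norm _ _)
  rcases (norm_nonneg (p - q)).eq_or_lt with h | h
  · rw [← h]; positivity
  · exact le_of_mul_le_mul_right h4 h

end Projection

section Gradient

variable {E : Type*} [NormedAddCommGroup E] [InnerProductSpace ℝ E]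

/-- If `v ↦ 2 ⟪p, v⟫ - L ‖v‖ ^ 2` is bounded above by `c`, then `‖p‖ ^ 2 ≤ L * c`. -/
theorem norm_sq_le_mul_of_forall_inner_le {p : E} {L c : ℝ} (hL : 0 ≤ L)
    (h : ∀ v, 2 * ⟪p, v⟫_ℝ - L * ‖v‖ ^ 2 ≤ c) : ‖p‖ ^ 2 ≤ L * c := by
  have hc : 0 ≤ c := by simpa using h 0
  have hd : discrim (L * ‖p‖ ^ 2) (-2 * ‖p‖ ^ 2) c ≤ 0 := by
    refine discrim_le_zero fun s => ?_
    have := h (s • p)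
    rw [real_inner_smul_right, real_inner_self_eq_norm_sq, norm_smul, mul_pow,
      Real.norm_eq_abs, sq_abs] at this
    linarith
  rcases (sq_nonneg ‖p‖).eq_or_lt with hp | hp
  · rw [← hp]; positivity
  · refine le_of_mul_le_mul_right ?_ hp
    unfold discrim at hd
    linarith

theorem hasDerivAt_norm_add_smul_sq (x v : E) (t : ℝ) :
    HasDerivAt (fun s : ℝ => ‖x + s • v‖ ^ 2) (2 * ⟪x + t • v, v⟫_ℝ) t := by
  have hline : HasDerivAt (fun s : ℝ => x + s • v) v t := by
    simpa using ((hasDerivAt_id t).smul_const v).const_add x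
  exact hline.norm_sq

variable [CompleteSpace E] {f : E → ℝ} {g : E → E} {α β : ℝ}

theorem HasGradientAt.hasDerivAt_comp_add_smul {g' x v : E} {t : ℝ}
    (h : HasGradientAt f g' (x + t • v)) :
    HasDerivAt (fun s : ℝ => f (x + s • v)) ⟪g', v⟫_ℝ t := by
  have hline : HasDerivAt (fun s : ℝ => x + s • v) v t := by
    simpa using ((hasDerivAt_id t).smul_const v).const_add x
  have hcomp := h.hasFDerivAt.comp_hasDerivAt t hline
  rwa [InnerProductSpace.toDual_apply_apply] at hcomp

/-- Quadratic lower bound for a differentiable strongly convex function. -/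
theorem ConvexOn.add_inner_gradient_add_le
    (hsc : ConvexOn ℝ Set.univ fun x => f x - α / 2 * ‖x‖ ^ 2) {x g' : E}
    (hg : HasGradientAt f g' x) (v : E) :
    f x + ⟪g', v⟫_ℝ + α / 2 * ‖v‖ ^ 2 ≤ f (x + v) := by
  have hconv : ConvexOn ℝ Set.univ fun t : ℝ => f (x + t • v) - α / 2 * ‖x + t • v‖ ^ 2 := by
    refine ⟨convex_univ, fun s _ t _ a b ha hb hab => ?_⟩
    have key := hsc.2 (Set.mem_univ (x + s • v)) (Set.mem_univ (x + t • v)) ha hb hab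
    have hpt : a • (x + s • v) + b • (x + t • v) = x + (a • s + b • t) • v := by
      rw [smul_add, smul_add, add_smul, smul_smul, smul_smul, add_add_add_comm, ← add_smul, hab,
        one_smul, smul_eq_mul, smul_eq_mul]
    rwa [hpt] at key
  have hf : HasDerivAt (fun t : ℝ => f (x + t • v)) ⟪g', v⟫_ℝ 0 :=
    HasGradientAt.hasDerivAt_comp_add_smul (by simpa using hg)
  have hd := hf.sub ((hasDerivAt_norm_add_smul_sq x v 0).const_mul (α / 2))
  have hle := hconv.le_slope_of_hasDerivAt (Set.mem_univ 0) (Set.mem_univ 1) one_pos hd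
  simp only [slope_def_field, zero_smul, one_smul, add_zero, sub_zero, div_one,
    norm_add_sq_real, inner_zero_right, norm_zero] at hle
  linarith

/-- Descent lemma: quadratic upper bound for a function with Lipschitz gradient. -/
theorem le_add_inner_gradient_add (hg : ∀ x, HasGradientAt f (g x) x)
    (hlip : ∀ x y, ‖g x - g y‖ ≤ β * ‖x - y‖) (x v : E) :
    f (x + v) ≤ f x + ⟪g x, v⟫_ℝ + β / 2 * ‖v‖ ^ 2 := by
  have hd : ∀ t : ℝ, HasDerivAt
      (fun s : ℝ => f (x + s • v) - (s * ⟪g x, v⟫_ℝ + s ^ 2 * (β / 2 * ‖v‖ ^ 2)))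
      (⟪g (x + t • v), v⟫_ℝ - (⟪g x, v⟫_ℝ + 2 * t * (β / 2 * ‖v‖ ^ 2))) t := fun t => by
    have h1 := (hasDerivAt_id t).mul_const ⟪g x, v⟫_ℝ
    have h2 := (hasDerivAt_pow 2 t).mul_const (β / 2 * ‖v‖ ^ 2)
    refine ((hg (x + t • v)).hasDerivAt_comp_add_smul.sub (h1.add h2)).congr_deriv ?_
    simp
  have hanti := antitoneOn_of_deriv_nonpos (convex_Icc (0 : ℝ) 1)
    (fun t _ => (hd t).continuousAt.continuousWithinAt)
    (fun t _ => (hd t).differentiableAt.differentiableWithinAt) fun t ht => by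
      rw [interior_Icc] at ht
      rw [(hd t).deriv]
      have h1 := real_inner_le_norm (g (x + t • v) - g x) v
      have h2 := hlip (x + t • v) x
      rw [add_sub_cancel_left, norm_smul, Real.norm_of_nonneg ht.1.le] at h2
      have h3 := mul_le_mul_of_nonneg_right h2 (norm_nonneg v)
      rw [inner_sub_left] at h1
      linarith
  have := hanti (Set.left_mem_Icc.2 zero_le_one) (Set.right_mem_Icc.2 zero_le_one) zero_le_one
  simp only [zero_smul, one_smul, add_zero] at this
  linarith

/-- Strengthened coercivity of the gradient of a smooth, strongly convex function. -/
theorem norm_gradient_sub_sub_smul_sq_le (hαβ : α ≤ β) (hg : ∀ x, HasGradientAt f (g x) x)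
    (hsc : ConvexOn ℝ Set.univ fun x => f x - α / 2 * ‖x‖ ^ 2)
    (hlip : ∀ x y, ‖g x - g y‖ ≤ β * ‖x - y‖) (x y : E) :
    ‖g x - g y - α • (x - y)‖ ^ 2 ≤ (β - α) * ⟪g x - g y - α • (x - y), x - y⟫_ℝ := by
  refine norm_sq_le_mul_of_forall_inner_le (sub_nonneg.2 hαβ) fun v => ?_
  have h1 := hsc.add_inner_gradient_add_le (hg x) (v - (x - y))
  have h2 := le_add_inner_gradient_add hg hlip y v
  have h3 := hsc.add_inner_gradient_add_le (hg y) (-(v - (x - y)))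
  have h4 := le_add_inner_gradient_add hg hlip x (-v)
  rw [show x + (v - (x - y)) = y + v by abel] at h1
  rw [show y + -(v - (x - y)) = x + -v by abel] at h3
  rw [norm_neg] at h3 h4
  rw [norm_sub_sq_real v (x - y)] at h1 h3
  have h5 := real_inner_self_eq_norm_sq (x - y)
  have h6 := real_inner_comm v (x - y)
  generalize x - y = u at *
  simp only [inner_sub_left, inner_sub_right, inner_neg_right, real_inner_smul_left] at *
  rw [h5, h6]
  linarith

/-- Lipschitz constant of a gradient step for a smooth, strongly convex function. -/
theorem norm_gradient_step_sub_le (hαβ : α ≤ β) (hg : ∀ x, HasGradientAt f (g x) x)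
    (hsc : ConvexOn ℝ Set.univ fun x => f x - α / 2 * ‖x‖ ^ 2)
    (hlip : ∀ x y, ‖g x - g y‖ ≤ β * ‖x - y‖) {η : ℝ} (hη : 0 ≤ η) (x y : E) :
    ‖(x - η • g x) - (y - η • g y)‖ ≤ max |1 - η * α| |1 - η * β| * ‖x - y‖ := by
  have hco := norm_gradient_sub_sub_smul_sq_le hαβ hg hsc hlip x y
  set p := g x - g y - α • (x - y) with hp
  have hw : ‖p - ((β - α) / 2) • (x - y)‖ ≤ (β - α) / 2 * ‖x - y‖ := by
    refine le_of_sq_le_sq ?_ (mul_nonneg (by linarith) (norm_nonneg _))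
    rw [norm_sub_sq_real, real_inner_smul_right, norm_smul, Real.norm_eq_abs, mul_pow, sq_abs]
    linarith
  have hstep : (x - η • g x) - (y - η • g y) =
      (1 - η * ((α + β) / 2)) • (x - y) - η • (p - ((β - α) / 2) • (x - y)) := by
    rw [hp]; module
  have hmax : |1 - η * ((α + β) / 2)| + η * ((β - α) / 2) ≤ max |1 - η * α| |1 - η * β| := by
    rcases abs_cases (1 - η * ((α + β) / 2)) with ⟨h, -⟩ | ⟨h, -⟩ <;> rw [h]
    · exact le_max_of_le_left ((le_of_eq (by ring)).trans (le_abs_self _))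
    · exact le_max_of_le_right ((le_of_eq (by ring)).trans (neg_le_abs _))
  calc ‖(x - η • g x) - (y - η • g y)‖
      ≤ |1 - η * ((α + β) / 2)| * ‖x - y‖ + η * ((β - α) / 2 * ‖x - y‖) := by
        rw [hstep]
        refine (norm_sub_le _ _).trans ?_
        rw [norm_smul, norm_smul, Real.norm_eq_abs, Real.norm_of_nonneg hη]
        gcongr
    _ = (|1 - η * ((α + β) / 2)| + η * ((β - α) / 2)) * ‖x - y‖ := by ring
    _ ≤ _ := by gcongr

end Gradient

theorem max_abs_add_lt_one {α β ε η : ℝ} (hα : 0 < α) (hαβ : α ≤ β) (hε : 0 ≤ ε)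
    (hsmall : β * ε / α < 1) (hη0 : 0 < η) (hη1 : η < 2 / (β * (1 + ε))) :
    max |1 - η * α| |1 - η * β| + η * β * ε < 1 := by
  have hβ : 0 < β := hα.trans_le hαβ
  rw [div_lt_one hα] at hsmall
  rw [lt_div_iff₀ (by positivity)] at hη1
  have h1 := mul_lt_mul_of_pos_left hsmall hη0
  have h2 := mul_le_mul_of_nonneg_left hαβ hη0.le
  rw [← lt_sub_iff_add_lt, max_lt_iff, abs_lt, abs_lt]
  refine ⟨⟨?_, ?_⟩, ?_, ?_⟩ <;> linarith


/-- Linear convergence of (time-invariant) online projected gradient descent to the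
performatively stable point: with step size `η ∈ (0, 2/(β(1+ε)))`, the factor
`λ = max{|1 − ηα|, |1 − ηβ|} + ηβε` satisfies `λ < 1` and the iterates contract:
`‖x_{t+1} − x̄‖ ≤ λ ‖x_t − x̄‖`, hence `‖x_t − x̄‖ ≤ λ^t ‖x_0 − x̄‖`. -/
theorem opgd_linear_convergence
    {E : Type*} [NormedAddCommGroup E] [InnerProductSpace ℝ E]
    [FiniteDimensional ℝ E]
    (C : Set E) (hCne : C.Nonempty) (hCclosed : IsClosed C) (hCconv : Convex ℝ C)
    (proj : E → E)
    (hproj : ∀ x, proj x ∈ C ∧ ∀ u ∈ C, ‖x - proj x‖ ≤ ‖x - u‖)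
    (f : E → E → ℝ) (g : E → E → E) (α β ε η : ℝ)
    (hα : 0 < α) (hαβ : α ≤ β) (hε : 0 ≤ ε) (hsmall : β * ε / α < 1)
    (hη0 : 0 < η) (hη1 : η < 2 / (β * (1 + ε)))
    (hgrad : ∀ y x, HasGradientAt (fun x' => f x' y) (g x y) x)
    (hsc : ∀ y, ConvexOn ℝ Set.univ (fun x => f x y - α / 2 * ‖x‖ ^ 2))
    (hglip : ∀ y x x', ‖g x y - g x' y‖ ≤ β * ‖x - x'‖)
    (hsens : ∀ x y y', ‖g x y - g x y'‖ ≤ β * ε * ‖y - y'‖)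
    (xb : E) (hxb : xb = proj (xb - η • g xb xb))
    (x : ℕ → E) (hx : ∀ t, x (t + 1) = proj (x t - η • g (x t) (x t))) :
    max |1 - η * α| |1 - η * β| + η * β * ε < 1 ∧
      (∀ t, ‖x (t + 1) - xb‖ ≤
          (max |1 - η * α| |1 - η * β| + η * β * ε) * ‖x t - xb‖) ∧
      ∀ t, ‖x t - xb‖ ≤
          (max |1 - η * α| |1 - η * β| + η * β * ε) ^ t * ‖x 0 - xb‖ := by

  have hlt := max_abs_add_lt_one hα hαβ hε hsmall hη0 hη1
  have hstep : ∀ t, ‖x (t + 1) - xb‖ ≤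
      (max |1 - η * α| |1 - η * β| + η * β * ε) * ‖x t - xb‖ := fun t => by
    have hnonexp : ‖x (t + 1) - xb‖ ≤ ‖(x t - η • g (x t) (x t)) - (xb - η • g xb xb)‖ := by
      have h := hCconv.norm_nearest_sub_nearest_le
        (hproj (x t - η • g (x t) (x t))).1 (hproj (x t - η • g (x t) (x t))).2
        (hproj (xb - η • g xb xb)).1 (hproj (xb - η • g xb xb)).2
      rwa [← hx t, ← hxb] at h
    have hgs := norm_gradient_step_sub_le hαβ (hgrad xb) (hsc xb) (hglip xb) hη0.le (x t) xb
    have hshift : ‖η • (g (x t) (x t) - g (x t) xb)‖ ≤ η * (β * ε * ‖x t - xb‖) := by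
      rw [norm_smul, Real.norm_of_nonneg hη0.le]
      exact mul_le_mul_of_nonneg_left (hsens _ _ _) hη0.le
    have hsplit : (x t - η • g (x t) (x t)) - (xb - η • g xb xb) =
        ((x t - η • g (x t) xb) - (xb - η • g xb xb)) - η • (g (x t) (x t) - g (x t) xb) := by
      module
    have htri := norm_sub_le ((x t - η • g (x t) xb) - (xb - η • g xb xb))
      (η • (g (x t) (x t) - g (x t) xb))
    rw [← hsplit] at htri
    linarith
  refine ⟨hlt, hstep, fun t => ?_⟩
  have hnonneg : 0 ≤ max |1 - η * α| |1 - η * β| + η * β * ε := by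
    have hβ : 0 < β := hα.trans_le hαβ
    positivity
  induction t with
  | zero => simp
  | succ t ih =>
    rw [pow_succ', mul_assoc]
    exact (hstep t).trans (mul_le_mul_of_nonneg_left ih hnonneg)
end
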